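/- arXiv:2003.02466 — 3 statements merged into one kernel-verified Lean document; each statement's English description precedes it below -/
import Mathlib

section
/- Let N ≥ 2 be an integer. The function L₂ defined on (0, π) by L₂(β) = (sin β)^N / ∫_0^β (sin θ)^N dθ is strictly decreasing on (0, π). -/
open Real

theorem hasDerivAt_integral_sin_pow (N : ℕ) (x : ℝ) :
    HasDerivAt (fun β : ℝ => ∫ θ in (0:ℝ)..β, sin θ ^ N) (sin x ^ N) x := by
  have hc : Continuous fun θ : ℝ => sin θ ^ N := by fun_prop
  exact hc.integral_hasStrictDerivAt 0 x |>.hasDerivAt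

theorem integral_sin_pow_pos_of_mem_Ioo (N : ℕ) {x : ℝ} (hx : x ∈ Set.Ioo 0 π) :
    0 < ∫ θ in (0:ℝ)..x, sin θ ^ N := by
  have hc : Continuous fun θ : ℝ => sin θ ^ N := by fun_prop
  exact intervalIntegral.intervalIntegral_pos_of_pos_on (hc.intervalIntegrable _ _)
    (fun θ hθ => pow_pos (sin_pos_of_pos_of_lt_pi hθ.1 (hθ.2.trans hx.2)) N) hx.1

theorem mul_cos_mul_integral_sin_pow_lt (N : ℕ) {x : ℝ} (hx : x ∈ Set.Ioo 0 π) :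
    N * cos x * (∫ θ in (0:ℝ)..x, sin θ ^ N) < sin x ^ (N + 1) := by
  have hs : 0 < sin x ^ (N + 1) := pow_pos (sin_pos_of_pos_of_lt_pi hx.1 hx.2) _
  rcases le_or_gt (π / 2) x with h | h
  · have hcos : cos x ≤ 0 := cos_nonpos_of_pi_div_two_le_of_le h (by linarith [hx.2, pi_pos])
    have hI := integral_sin_pow_pos_of_mem_Ioo N hx
    exact (mul_nonpos_of_nonpos_of_nonneg
      (mul_nonpos_of_nonneg_of_nonpos N.cast_nonneg hcos) hI.le).trans_lt hs
  · have hd (y : ℝ) : HasDerivAt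
        (fun y => sin y ^ (N + 1) - N * cos y * ∫ θ in (0:ℝ)..y, sin θ ^ N)
        (sin y ^ N * cos y + N * sin y * ∫ θ in (0:ℝ)..y, sin θ ^ N) y := by
      refine (((hasDerivAt_sin y).pow (N + 1)).sub (((hasDerivAt_cos y).const_mul (N : ℝ)).mul
        (hasDerivAt_integral_sin_pow N y))).congr_deriv ?_
      simp only [Nat.add_sub_cancel, Nat.cast_add, Nat.cast_one]
      ring
    have hmono := strictMonoOn_of_deriv_pos (convex_Icc 0 (π / 2))
      (fun y _ => (hd y).continuousAt.continuousWithinAt) (fun y hy => by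
        rw [interior_Icc] at hy
        rw [(hd y).deriv]
        have hy' : y ∈ Set.Ioo 0 π := ⟨hy.1, by linarith [hy.2, pi_pos]⟩
        have hsin := sin_pos_of_pos_of_lt_pi hy'.1 hy'.2
        have hcos : 0 < cos y := cos_pos_of_mem_Ioo ⟨by linarith [hy.1, pi_pos], hy.2⟩
        have hI := integral_sin_pow_pos_of_mem_Ioo N hy'
        positivity)
    have := hmono ⟨le_rfl, by positivity⟩ ⟨hx.1.le, h.le⟩ hx.1
    simpa using this

theorem stmt_7 (N : ℕ) (hN : 2 ≤ N) :
    StrictAntiOn (fun β : ℝ => sin β ^ N / ∫ θ in (0:ℝ)..β, sin θ ^ N) (Set.Ioo 0 π) := by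
  have hd (x : ℝ) (hx : x ∈ Set.Ioo 0 π) :=
    ((hasDerivAt_sin x).pow N).div (hasDerivAt_integral_sin_pow N x)
      (integral_sin_pow_pos_of_mem_Ioo N hx).ne'
  refine strictAntiOn_of_deriv_neg (convex_Ioo 0 π)
    (fun x hx => (hd x hx).continuousAt.continuousWithinAt) fun x hx => ?_
  rw [interior_Ioo] at hx
  refine (hd x hx).deriv.trans_lt
    (div_neg_of_neg_of_pos ?_ (pow_pos (integral_sin_pow_pos_of_mem_Ioo N hx) 2))
  have hsin := pow_pos (sin_pos_of_pos_of_lt_pi hx.1 hx.2) (N - 1)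
  have hlt := mul_lt_mul_of_pos_left (mul_cos_mul_integral_sin_pow_lt N hx) hsin
  have hpow : sin x ^ (N - 1) * sin x ^ (N + 1) = sin x ^ N * sin x ^ N := by
    rw [← pow_add, ← pow_add]
    congr 1
    omega
  simp only [Pi.pow_apply]
  linarith
end

section
/- Let N ≥ 2 be an integer, let ρ > 0, V > 0, ω > 0 and γ ∈ ℝ. Define, for α ∈ (0, π), R(α) = (V/(ρ·ω·I₋(α)))^{1/N} and G(α) = (N−1)·ρ·ω·R(α)^{N−1}·J₋(α) + γ·ω·R(α)^{N−1}·(sin α)^{N−1}, where I₋(α) = ∫_α^π (sin θ)^N dθ and J₋(α) = ∫_α^π (sin θ)^{N−2} dθ. Then G is differentiable on (0, π) and G'(α) = ((N−1)·ω·R(α)^{N−1}·(sin α)^{N−2} / (N·I₋(α))) · ((N−1)·J₋(α)·cos α + (sin α)^{N−1}) · (γ − ρ·cos α). -/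
open Real

noncomputable def Im (N : ℕ) (α : ℝ) : ℝ := ∫ θ in α..π, sin θ ^ N

noncomputable def Jm (N : ℕ) (α : ℝ) : ℝ := ∫ θ in α..π, sin θ ^ (N - 2)

noncomputable def capRadius (N : ℕ) (ρ V ω α : ℝ) : ℝ :=
  (V / (ρ * ω * Im N α)) ^ ((1 : ℝ) / N)

theorem hasDerivAt_integral_sin_pow_left (n : ℕ) (α b : ℝ) :
    HasDerivAt (fun a : ℝ => ∫ θ in a..b, sin θ ^ n) (-sin α ^ n) α := by
  have hc : Continuous fun θ : ℝ => sin θ ^ n := by fun_prop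
  exact intervalIntegral.integral_hasDerivAt_left (hc.intervalIntegrable _ _)
    hc.aestronglyMeasurable.stronglyMeasurableAtFilter hc.continuousAt

theorem Im_pos (N : ℕ) {α : ℝ} (hα : α ∈ Set.Ioo (0 : ℝ) π) : 0 < Im N α := by
  have hc : Continuous fun θ : ℝ => sin θ ^ N := by fun_prop
  exact intervalIntegral.intervalIntegral_pos_of_pos_on (hc.intervalIntegrable _ _)
    (fun x hx => pow_pos (sin_pos_of_pos_of_lt_pi (hα.1.trans hx.1) hx.2) N) hα.2

theorem Im_add_two (n : ℕ) (α : ℝ) :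
    ((n : ℝ) + 2) * Im (n + 2) α =
      ((n : ℝ) + 1) * Jm (n + 2) α + sin α ^ (n + 1) * cos α := by
  have h := integral_sin_pow (a := α) (b := π) n
  have hn : (n : ℝ) + 2 ≠ 0 := by positivity
  simp only [Im, Jm, Nat.add_sub_cancel, h, sin_pi]
  field_simp
  ring

theorem hasDerivAt_capRadius {N : ℕ} (hN : N ≠ 0) {ρ V ω α : ℝ}
    (hρ : 0 < ρ) (hV : 0 < V) (hω : 0 < ω) (hα : α ∈ Set.Ioo (0 : ℝ) π) :
    HasDerivAt (capRadius N ρ V ω)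
      (capRadius N ρ V ω α * sin α ^ N / (N * Im N α)) α := by
  have hI := Im_pos N hα
  have hN' : (N : ℝ) ≠ 0 := by exact_mod_cast hN
  have hden : ρ * ω * Im N α ≠ 0 := by positivity
  have hq : 0 < V / (ρ * ω * Im N α) := by positivity
  have hIm : HasDerivAt (Im N) (-sin α ^ N) α := hasDerivAt_integral_sin_pow_left N α π
  have h := (((hIm.const_mul (ρ * ω)).fun_inv hden).const_mul V).rpow_const
    (p := (1 : ℝ) / N) (Or.inl (by positivity))
  refine h.congr_deriv ?_
  rw [← div_eq_mul_inv, rpow_sub_one hq.ne']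
  simp only [capRadius]
  field_simp

theorem stmt_11 (N : ℕ) (hN : 2 ≤ N) (ρ V ω γ : ℝ)
    (hρ : 0 < ρ) (hV : 0 < V) (hω : 0 < ω) :
    ∀ α ∈ Set.Ioo (0:ℝ) π,
      HasDerivAt
        (fun a : ℝ =>
          ((N : ℝ) - 1) * ρ * ω * capRadius N ρ V ω a ^ (N - 1) * Jm N a +
            γ * ω * capRadius N ρ V ω a ^ (N - 1) * sin a ^ (N - 1))
        ((((N : ℝ) - 1) * ω * capRadius N ρ V ω α ^ (N - 1) * sin α ^ (N - 2) /
            ((N : ℝ) * Im N α)) *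
          (((N : ℝ) - 1) * Jm N α * cos α + sin α ^ (N - 1)) *
          (γ - ρ * cos α)) α := by
  intro α hα
  obtain ⟨n, rfl⟩ := Nat.exists_eq_add_of_le' hN
  have hI := Im_pos (n + 2) hα
  have hrec := Im_add_two n α
  have hP := (hasDerivAt_capRadius (N := n + 2) (by omega) hρ hV hω hα).fun_pow (n + 1)
  have hJ : HasDerivAt (Jm (n + 2)) (-sin α ^ n) α := hasDerivAt_integral_sin_pow_left n α π
  have hs := (hasDerivAt_sin α).fun_pow (n + 1)
  have h := ((hP.const_mul ((((n + 2 : ℕ) : ℝ) - 1) * ρ * ω)).mul hJ).add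
    ((hP.const_mul (γ * ω)).mul hs)
  refine h.congr_deriv ?_
  rw [show n + 2 - 1 = n + 1 by omega, show n + 2 - 2 = n by omega]
  simp only [Nat.add_sub_cancel]
  push_cast
  generalize capRadius (n + 2) ρ V ω α = R
  generalize Jm (n + 2) α = J at *
  generalize Im (n + 2) α = I at *
  have hn : (n : ℝ) + 2 ≠ 0 := by positivity
  have hsc := sin_sq_add_cos_sq α
  generalize sin α = s at *
  generalize cos α = c at *
  field_simp
  linear_combination ((n : ℝ) + 1) * R ^ (n + 1) * s ^ n *
    ((γ * c - ρ) * hrec + (γ * s ^ (n + 1) + ρ * (n + 1) * J) * hsc)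
end

section
/- Let N ≥ 2 be an integer and ρ₋, ρ₊, V₋, V₊, ω > 0 with V₋/ρ₋ > V₊/ρ₊, and set m = min(ρ₋, ρ₊). Define L(γ) = (V₋/(ω·ρ₋)) · (sin α(γ))^N / I₋(α(γ)) − (V₊/(ω·ρ₊)) · (sin β(γ))^N / I₊(β(γ)) for γ ∈ (−m, m), where α(γ) = arccos(γ/ρ₋), β(γ) = arccos(γ/ρ₊), I₋(α) = ∫_α^π (sin θ)^N dθ, I₊(β) = ∫_0^β (sin θ)^N dθ. If γ⋆ ∈ (−m, m) satisfies L(γ⋆) = 0, then γ⋆ > 0. -/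
open Real

noncomputable def Ip (N : ℕ) (β : ℝ) : ℝ := ∫ θ in (0:ℝ)..β, sin θ ^ N

noncomputable def L (N : ℕ) (ρm ρp Vm Vp ω γ : ℝ) : ℝ :=
  Vm / (ω * ρm) * (sin (arccos (γ / ρm)) ^ N / Im N (arccos (γ / ρm))) -
    Vp / (ω * ρp) * (sin (arccos (γ / ρp)) ^ N / Ip N (arccos (γ / ρp)))

theorem Ip_pos (N : ℕ) {β : ℝ} (h0 : 0 < β) (h1 : β ≤ π) : 0 < Ip N β := by
  refine intervalIntegral.intervalIntegral_pos_of_pos_on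
    (Continuous.intervalIntegrable (by fun_prop) _ _) (fun x hx => ?_) h0
  exact pow_pos (sin_pos_of_pos_of_lt_pi hx.1 (hx.2.trans_le h1)) N

theorem Im_eq_Ip_pi_sub (N : ℕ) (α : ℝ) : Im N α = Ip N (π - α) := by
  have h := intervalIntegral.integral_comp_sub_left (fun θ => sin θ ^ N) (a := α) (b := π) π
  simpa [Im, Ip, sin_pi_sub] using h

theorem hasDerivAt_Ip (N : ℕ) (β : ℝ) : HasDerivAt (Ip N) (sin β ^ N) β :=
  (by fun_prop : Continuous fun θ : ℝ => sin θ ^ N).integral_hasStrictDerivAt 0 β |>.hasDerivAt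

theorem cos_mul_Ip_le (N : ℕ) {β : ℝ} (h0 : 0 ≤ β) (h1 : β ≤ π) :
    N * (cos β * Ip N β) ≤ sin β ^ (N + 1) := by
  have hint : ∫ θ in (0:ℝ)..β, ((N + 1 : ℕ) : ℝ) * sin θ ^ N * cos θ = sin β ^ (N + 1) := by
    rw [intervalIntegral.integral_eq_sub_of_hasDerivAt (f := fun θ => sin θ ^ (N + 1))]
    · simp
    · intro x _
      exact (hasDerivAt_sin x).pow (N + 1)
    · exact Continuous.intervalIntegrable (by fun_prop) _ _
  have hle : ((N + 1 : ℕ) : ℝ) * (cos β * Ip N β) ≤ sin β ^ (N + 1) := by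
    rw [← hint, Ip, ← intervalIntegral.integral_const_mul, ← intervalIntegral.integral_const_mul]
    refine intervalIntegral.integral_mono_on h0 (Continuous.intervalIntegrable (by fun_prop) _ _)
      (Continuous.intervalIntegrable (by fun_prop) _ _) fun x hx => ?_
    have hc : cos β ≤ cos x := cos_le_cos_of_nonneg_of_le_pi hx.1 h1 hx.2
    have hs : 0 ≤ sin x ^ N := pow_nonneg (sin_nonneg_of_nonneg_of_le_pi hx.1 (hx.2.trans h1)) N
    rw [mul_assoc, mul_comm (cos β)]
    gcongr
  have hs : 0 ≤ sin β ^ (N + 1) := pow_nonneg (sin_nonneg_of_nonneg_of_le_pi h0 h1) _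
  rcases le_total 0 (cos β * Ip N β) with h | h
  · push_cast at hle
    linarith
  · exact (mul_nonpos_of_nonneg_of_nonpos N.cast_nonneg h).trans hs

theorem antitoneOn_sin_pow_div_Ip {N : ℕ} (hN : N ≠ 0) :
    AntitoneOn (fun β => sin β ^ N / Ip N β) (Set.Ioo 0 π) := by
  have hd : ∀ β ∈ Set.Ioo (0:ℝ) π, HasDerivAt (fun β => sin β ^ N / Ip N β)
      ((N * sin β ^ (N - 1) * cos β * Ip N β - sin β ^ N * sin β ^ N) / Ip N β ^ 2) β :=
    fun β hβ => ((hasDerivAt_sin β).pow N).div (hasDerivAt_Ip N β) (Ip_pos N hβ.1 hβ.2.le).ne'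
  refine antitoneOn_of_deriv_nonpos (convex_Ioo 0 π)
    (fun β hβ => (hd β hβ).continuousAt.continuousWithinAt) ?_ ?_ <;> rw [interior_Ioo]
  · exact fun β hβ => (hd β hβ).differentiableAt.differentiableWithinAt
  · intro β hβ
    rw [(hd β hβ).deriv]
    refine div_nonpos_of_nonpos_of_nonneg ?_ (sq_nonneg _)
    have hs : 0 ≤ sin β ^ (N - 1) := pow_nonneg (sin_pos_of_pos_of_lt_pi hβ.1 hβ.2).le _
    have h := mul_le_mul_of_nonneg_left (cos_mul_Ip_le N hβ.1.le hβ.2.le) hs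
    obtain ⟨k, rfl⟩ := Nat.exists_eq_succ_of_ne_zero hN
    simp only [Nat.succ_eq_add_one, Nat.add_sub_cancel] at h ⊢
    linear_combination h

theorem stmt_16 (N : ℕ) (hN : 2 ≤ N) (ρm ρp Vm Vp ω : ℝ)
    (hρm : 0 < ρm) (hρp : 0 < ρp) (hVm : 0 < Vm) (hVp : 0 < Vp) (hω : 0 < ω)
    (hV : Vm / ρm > Vp / ρp) (γstar : ℝ)
    (hγstar : γstar ∈ Set.Ioo (-(min ρm ρp)) (min ρm ρp))
    (hL : L N ρm ρp Vm Vp ω γstar = 0) :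
    γstar > 0 := by
  by_contra! hγ
  obtain ⟨hlo, -⟩ := hγstar
  have hm : -ρm < γstar := (neg_le_neg (min_le_left _ _)).trans_lt hlo
  have hp : -ρp < γstar := (neg_le_neg (min_le_right _ _)).trans_lt hlo
  have hα0 : π / 2 ≤ arccos (γstar / ρm) := by
    rw [← arccos_zero]
    exact antitone_arccos (div_nonpos_of_nonpos_of_nonneg hγ hρm.le)
  have hβ0 : π / 2 ≤ arccos (γstar / ρp) := by
    rw [← arccos_zero]
    exact antitone_arccos (div_nonpos_of_nonpos_of_nonneg hγ hρp.le)
  have hα1 : arccos (γstar / ρm) < π := by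
    refine (arccos_le_pi _).lt_of_ne fun h => ?_
    rw [arccos_eq_pi, div_le_iff₀ hρm] at h
    linarith
  have hβ1 : arccos (γstar / ρp) < π := by
    refine (arccos_le_pi _).lt_of_ne fun h => ?_
    rw [arccos_eq_pi, div_le_iff₀ hρp] at h
    linarith
  rw [L] at hL
  set α := arccos (γstar / ρm)
  set β := arccos (γstar / ρp)
  have hπ := pi_pos
  have hanti : sin β ^ N / Ip N β ≤ sin α ^ N / Im N α := by
    rw [Im_eq_Ip_pi_sub, ← sin_pi_sub α]
    exact antitoneOn_sin_pow_div_Ip (by omega) ⟨by linarith, by linarith⟩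
      ⟨by linarith, hβ1⟩ (by linarith)
  have hpos : 0 < sin β ^ N / Ip N β :=
    div_pos (pow_pos (sin_pos_of_pos_of_lt_pi (by linarith) hβ1) N)
      (Ip_pos N (by linarith) hβ1.le)
  have hcoef : Vp / (ω * ρp) < Vm / (ω * ρm) := by
    rw [mul_comm ω, mul_comm ω, ← div_div, ← div_div]
    exact div_lt_div_of_pos_right hV hω
  have hlt := mul_lt_mul hcoef hanti hpos (by positivity)
  linarith
end
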